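/- arXiv:2505.05079 — 2 statements merged into one kernel-verified Lean document; each statement's English description precedes it below -/
import Mathlib

section
/- For all integers k ≥ 2 and n ≥ k, spt_k^d(n) + spt_{k−1}^d(n) = spt_{k−1}^d(n−k+1) + p_d(n−k+1). -/
/-!
Definitions following Andrews–El Bachraoui / Chen–Chen–Zhao:
partitions with repeated smallest part.
-/

/-- The smallest part of `π` occurs exactly `k` times and all remaining parts
occur exactly once (are distinct). -/
def IsSptD (k : ℕ) {n : ℕ} (π : n.Partition) : Prop :=
  ∃ s ∈ π.parts, (∀ x ∈ π.parts, s ≤ x) ∧ Multiset.count s π.parts = k ∧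
    ∀ x ∈ π.parts, x ≠ s → Multiset.count x π.parts = 1

/-- `spt k_d(n)`: the number of partitions of `n` whose smallest part occurs
exactly `k` times and whose remaining parts are distinct. -/
noncomputable def sptd (k n : ℕ) : ℕ :=
  Nat.card {π : n.Partition // IsSptD k π}

/-- The smallest part `s` of `π` occurs exactly `k` times, and all remaining parts
occur exactly once and are incongruent to `s` modulo 2. -/
def IsSptDO (k : ℕ) {n : ℕ} (π : n.Partition) : Prop :=
  ∃ s ∈ π.parts, (∀ x ∈ π.parts, s ≤ x) ∧ Multiset.count s π.parts = k ∧
    ∀ x ∈ π.parts, x ≠ s → Multiset.count x π.parts = 1 ∧ ¬ x % 2 = s % 2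

/-- `spt k_{do}(n)`. -/
noncomputable def sptdo (k n : ℕ) : ℕ :=
  Nat.card {π : n.Partition // IsSptDO k π}

/-- As `IsSptDO`, with in addition an even number of parts strictly greater
than the smallest part. -/
def IsSptDOEven (k : ℕ) {n : ℕ} (π : n.Partition) : Prop :=
  ∃ s ∈ π.parts, (∀ x ∈ π.parts, s ≤ x) ∧ Multiset.count s π.parts = k ∧
    (∀ x ∈ π.parts, x ≠ s → Multiset.count x π.parts = 1 ∧ ¬ x % 2 = s % 2) ∧
    Even (Multiset.card (π.parts.filter fun x => s < x))

/-- As `IsSptDO`, with in addition an odd number of parts strictly greater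
than the smallest part. -/
def IsSptDOOdd (k : ℕ) {n : ℕ} (π : n.Partition) : Prop :=
  ∃ s ∈ π.parts, (∀ x ∈ π.parts, s ≤ x) ∧ Multiset.count s π.parts = k ∧
    (∀ x ∈ π.parts, x ≠ s → Multiset.count x π.parts = 1 ∧ ¬ x % 2 = s % 2) ∧
    Odd (Multiset.card (π.parts.filter fun x => s < x))

/-- `B₀(k,n)`. -/
noncomputable def B0 (k n : ℕ) : ℕ :=
  Nat.card {π : n.Partition // IsSptDOEven k π}

/-- `B₁(k,n)`. -/
noncomputable def B1 (k n : ℕ) : ℕ :=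
  Nat.card {π : n.Partition // IsSptDOOdd k π}

/-- `spt k'_{do}(n) = B₀(k,n) - B₁(k,n)`. -/
noncomputable def sptdo' (k n : ℕ) : ℤ :=
  (B0 k n : ℤ) - (B1 k n : ℤ)

/-- `p_d(n)`: number of partitions of `n` into distinct parts. -/
noncomputable def pd (n : ℕ) : ℕ :=
  Nat.card {π : n.Partition // π.parts.Nodup}

/-- `p_{de}(n)`: number of partitions of `n` into distinct even parts. -/
noncomputable def pde (n : ℕ) : ℕ :=
  Nat.card {π : n.Partition // π.parts.Nodup ∧ ∀ x ∈ π.parts, Even x}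

/-- `p_{do}(n)`: number of partitions of `n` into distinct odd parts. -/
noncomputable def pdo (n : ℕ) : ℕ :=
  Nat.card {π : n.Partition // π.parts.Nodup ∧ ∀ x ∈ π.parts, Odd x}

/-- `p'_{do}(n)`: partitions of `n` into an even number of distinct odd parts
minus those into an odd number of distinct odd parts. -/
noncomputable def pdo' (n : ℕ) : ℤ :=
  (Nat.card {π : n.Partition //
      π.parts.Nodup ∧ (∀ x ∈ π.parts, Odd x) ∧ Even (Multiset.card π.parts)} : ℤ) -
  (Nat.card {π : n.Partition //
      π.parts.Nodup ∧ (∀ x ∈ π.parts, Odd x) ∧ Odd (Multiset.card π.parts)} : ℤ)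

/-- Pairs `(s, E)` of a positive integer `s` and a finite set `E` of integers larger than `s`
with `k * s + ∑ E = n`. -/
def smallestPartPairs (k n : ℕ) : Set (ℕ × Finset ℕ) :=
  {p | 1 ≤ p.1 ∧ (∀ x ∈ p.2, p.1 < x) ∧ k * p.1 + ∑ x ∈ p.2, x = n}

/-- Finite sets of positive integers with sum `n`. -/
def distinctPartSets (n : ℕ) : Set (Finset ℕ) :=
  {E | 0 ∉ E ∧ ∑ x ∈ E, x = n}

/-- Pairs `(s, E)` of a positive integer `s` and a finite set `E` of integers at least `s`
with `k * s + ∑ E = n`. -/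
def weakSmallestPartPairs (k n : ℕ) : Set (ℕ × Finset ℕ) :=
  {p | 1 ≤ p.1 ∧ (∀ x ∈ p.2, p.1 ≤ x) ∧ k * p.1 + ∑ x ∈ p.2, x = n}

/-- The partition with `k` copies of `s` and the elements of `E` as parts. -/
def smallestPartPairs.toPartition {k n : ℕ} (p : smallestPartPairs k n) : n.Partition where
  parts := Multiset.replicate k p.1.1 + p.1.2.val
  parts_pos := by
    obtain ⟨⟨s, E⟩, h1, h2, h3⟩ := p
    intro i hi
    rcases Multiset.mem_add.1 hi with h | h
    · rw [Multiset.eq_of_mem_replicate h]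
      exact h1
    · exact lt_of_le_of_lt (Nat.zero_le _) (h2 i h)
  parts_sum := by
    obtain ⟨⟨s, E⟩, h1, h2, h3⟩ := p
    simpa [Finset.sum_val] using h3

theorem smallestPartPairs.isSptD_toPartition {k n : ℕ} (hk : 1 ≤ k)
    (p : smallestPartPairs k n) : IsSptD k (smallestPartPairs.toPartition p) := by
  obtain ⟨⟨s, E⟩, h1, h2, h3⟩ := p
  have hs : s ∉ E := fun h => lt_irrefl _ (h2 s h)
  simp only [smallestPartPairs.toPartition, IsSptD] at *
  refine ⟨s, ?_, ?_, ?_, ?_⟩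
  · exact Multiset.mem_add.2 (Or.inl (Multiset.mem_replicate.2 ⟨by omega, rfl⟩))
  · intro x hx
    rcases Multiset.mem_add.1 hx with h | h
    · rw [Multiset.eq_of_mem_replicate h]
    · exact (h2 x h).le
  · rw [Multiset.count_add, Multiset.count_replicate_self,
      Multiset.count_eq_zero_of_notMem (by simpa using hs), add_zero]
  · intro x hx hxs
    rcases Multiset.mem_add.1 hx with h | h
    · exact absurd (Multiset.eq_of_mem_replicate h) hxs
    · rw [Multiset.count_add, Multiset.count_replicate, if_neg (Ne.symm hxs), zero_add]
      exact Multiset.count_eq_one_of_mem E.nodup h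

theorem smallestPartPairs.toPartition_injective {k n : ℕ} (hk : 1 ≤ k) :
    Function.Injective (smallestPartPairs.toPartition (k := k) (n := n)) := by
  rintro ⟨⟨s, E⟩, h1, h2, h3⟩ ⟨⟨t, F⟩, h4, h5, h6⟩ h
  have hp := congrArg Nat.Partition.parts h
  simp only [smallestPartPairs.toPartition] at hp h2 h5
  have le : ∀ {s t : ℕ} {E F : Finset ℕ}, (∀ x ∈ F, t < x) →
      Multiset.replicate k s + E.val = Multiset.replicate k t + F.val → t ≤ s := by
    intro s t E F h5 hp
    have hm : s ∈ Multiset.replicate k t + F.val := by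
      rw [← hp]
      exact Multiset.mem_add.2 (Or.inl (Multiset.mem_replicate.2 ⟨by omega, rfl⟩))
    rcases Multiset.mem_add.1 hm with h | h
    · exact (Multiset.eq_of_mem_replicate h).ge
    · exact (h5 s h).le
  obtain rfl : s = t := le_antisymm (le h2 hp.symm) (le h5 hp)
  obtain rfl : E = F := Finset.val_injective (add_left_cancel hp)
  rfl

theorem smallestPartPairs.exists_toPartition_eq {k n : ℕ} {π : n.Partition} (h : IsSptD k π) :
    ∃ p : smallestPartPairs k n, (smallestPartPairs.toPartition p) = π := by
  obtain ⟨s, hs, hmin, hc, hd⟩ := h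
  have hparts : Multiset.replicate k s + (π.parts.toFinset.erase s).val = π.parts := by
    ext x
    rw [Multiset.count_add, Multiset.count_replicate]
    split_ifs with hx
    · subst hx
      rw [Multiset.count_eq_zero_of_notMem (Finset.notMem_erase s _), hc, add_zero]
    · rw [zero_add]
      by_cases hm : x ∈ π.parts
      · rw [hd x hm (Ne.symm hx)]
        exact Multiset.count_eq_one_of_mem (Finset.nodup _)
          (Finset.mem_erase.2 ⟨Ne.symm hx, Multiset.mem_toFinset.2 hm⟩)
      · rw [Multiset.count_eq_zero_of_notMem hm]
        exact Multiset.count_eq_zero_of_notMem fun h => hm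
          (Multiset.mem_toFinset.1 (Finset.mem_of_mem_erase h))
  refine ⟨⟨(s, π.parts.toFinset.erase s), π.parts_pos hs, ?_, ?_⟩, Nat.Partition.ext hparts⟩
  · intro x hx
    obtain ⟨hxs, hx⟩ := Finset.mem_erase.1 hx
    exact lt_of_le_of_ne (hmin x (Multiset.mem_toFinset.1 hx)) (Ne.symm hxs)
  · have := congrArg Multiset.sum hparts
    rwa [π.parts_sum, Multiset.sum_add, Multiset.sum_replicate, smul_eq_mul,
      Finset.sum_val] at this

theorem finite_smallestPartPairs {k : ℕ} (hk : 1 ≤ k) (n : ℕ) :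
    (smallestPartPairs k n).Finite :=
  Set.finite_coe_iff.1 (Finite.of_injective _ (smallestPartPairs.toPartition_injective hk))

theorem sptd_eq_ncard {k : ℕ} (hk : 1 ≤ k) (n : ℕ) :
    sptd k n = (smallestPartPairs k n).ncard := by
  symm
  refine Nat.card_eq_of_bijective
    (fun p : smallestPartPairs k n => (⟨(smallestPartPairs.toPartition p), smallestPartPairs.isSptD_toPartition hk p⟩ :
      {π : n.Partition // IsSptD k π})) ⟨?_, ?_⟩
  · intro p q h
    exact smallestPartPairs.toPartition_injective hk (congrArg Subtype.val h)
  · rintro ⟨π, hπ⟩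
    obtain ⟨p, rfl⟩ := smallestPartPairs.exists_toPartition_eq hπ
    exact ⟨p, rfl⟩

/-- Partitions into distinct parts are finite sets of positive integers. -/
def nodupPartitionEquiv (n : ℕ) :
    {π : n.Partition // π.parts.Nodup} ≃ distinctPartSets n where
  toFun π := ⟨⟨π.1.parts, π.2⟩, fun h => lt_irrefl _ (π.1.parts_pos h), by
    simpa [Finset.sum_val] using π.1.parts_sum⟩
  invFun E := ⟨⟨E.1.val, fun {i} hi => Nat.pos_of_ne_zero fun h => E.2.1 (h ▸ hi), by
    simpa [Finset.sum_val] using E.2.2⟩, E.1.nodup⟩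
  left_inv _ := rfl
  right_inv _ := rfl

theorem weakSmallestPartPairs_eq_union (j n : ℕ) :
    weakSmallestPartPairs j n = (fun p : ℕ × Finset ℕ => (p.1, insert p.1 p.2)) ''
      smallestPartPairs (j + 1) n ∪ smallestPartPairs j n := by
  ext ⟨s, E⟩
  simp only [weakSmallestPartPairs, smallestPartPairs, Set.mem_union, Set.mem_image,
    Set.mem_ofPred_eq, Prod.exists, Prod.mk.injEq]
  constructor
  · rintro ⟨h1, h2, h3⟩
    by_cases hs : s ∈ E
    · refine Or.inl ⟨s, E.erase s, ⟨h1, ?_, ?_⟩, rfl, Finset.insert_erase hs⟩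
      · intro x hx
        obtain ⟨hxs, hx⟩ := Finset.mem_erase.1 hx
        exact lt_of_le_of_ne (h2 x hx) (Ne.symm hxs)
      · have := Finset.add_sum_erase E (fun x => x) hs
        rw [add_one_mul]
        omega
    · exact Or.inr ⟨h1, fun x hx => lt_of_le_of_ne (h2 x hx) (fun h => hs (h ▸ hx)), h3⟩
  · rintro (⟨t, F, ⟨h1, h2, h3⟩, rfl, rfl⟩ | ⟨h1, h2, h3⟩)
    · refine ⟨h1, ?_, ?_⟩
      · intro x hx
        rcases Finset.mem_insert.1 hx with rfl | hx
        · exact le_rfl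
        · exact (h2 x hx).le
      · rw [Finset.sum_insert fun h => lt_irrefl _ (h2 t h), ← h3]
        ring
    · exact ⟨h1, fun x hx => (h2 x hx).le, h3⟩

theorem weakSmallestPartPairs_add_eq_union (j m : ℕ) :
    weakSmallestPartPairs j (m + j) = (fun p : ℕ × Finset ℕ => (p.1 + 1, p.2)) ''
      smallestPartPairs j m ∪ (fun E => (1, E)) '' distinctPartSets m := by
  ext ⟨s, E⟩
  simp only [weakSmallestPartPairs, smallestPartPairs, distinctPartSets, Set.mem_union,
    Set.mem_image, Set.mem_ofPred_eq, Prod.exists, Prod.mk.injEq]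
  constructor
  · rintro ⟨h1, h2, h3⟩
    obtain ⟨t, rfl⟩ := Nat.exists_eq_add_of_le' h1
    rw [mul_add_one] at h3
    rcases Nat.eq_zero_or_pos t with rfl | ht
    · exact Or.inr ⟨E, ⟨fun h => absurd (h2 0 h) (by omega), by omega⟩, rfl, rfl⟩
    · exact Or.inl ⟨t, E, ⟨ht, fun x hx => h2 x hx, by omega⟩, rfl, rfl⟩
  · rintro (⟨t, F, ⟨h1, h2, h3⟩, rfl, rfl⟩ | ⟨F, ⟨h1, h2⟩, rfl, rfl⟩)
    · refine ⟨by omega, fun x hx => h2 x hx, ?_⟩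
      rw [mul_add_one]
      omega
    · refine ⟨le_rfl, fun x hx => Nat.one_le_iff_ne_zero.2 fun h => h1 (h ▸ hx), by omega⟩

theorem ncard_weakSmallestPartPairs {j : ℕ} (hj : 1 ≤ j) (n : ℕ) :
    (weakSmallestPartPairs j n).ncard = sptd (j + 1) n + sptd j n := by
  rw [weakSmallestPartPairs_eq_union, Set.ncard_union_eq ?_
    ((finite_smallestPartPairs (by omega) n).image _) (finite_smallestPartPairs hj n),
    Set.InjOn.ncard_image, sptd_eq_ncard (by omega), sptd_eq_ncard hj]
  · rintro ⟨s, E⟩ ⟨-, h1, -⟩ ⟨t, F⟩ ⟨-, h2, -⟩ h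
    simp only [Prod.mk.injEq] at h h1 h2
    obtain ⟨rfl, h⟩ := h
    rw [← Finset.erase_insert fun h => lt_irrefl _ (h1 s h), h,
      Finset.erase_insert fun h => lt_irrefl _ (h2 s h)]
  · rw [Set.disjoint_left]
    rintro _ ⟨⟨s, E⟩, -, rfl⟩ ⟨-, h, -⟩
    exact lt_irrefl _ (h s (Finset.mem_insert_self s E))

theorem ncard_weakSmallestPartPairs_add {j : ℕ} (hj : 1 ≤ j) (m : ℕ) :
    (weakSmallestPartPairs j (m + j)).ncard = sptd j m + pd m := by
  have hfin : (distinctPartSets m).Finite :=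
    Set.finite_coe_iff.1 (Finite.of_equiv _ (nodupPartitionEquiv m))
  rw [weakSmallestPartPairs_add_eq_union, Set.ncard_union_eq ?_
    ((finite_smallestPartPairs hj m).image _) (hfin.image _),
    Set.ncard_image_of_injective, Set.ncard_image_of_injective, sptd_eq_ncard hj, pd,
    Nat.card_congr (nodupPartitionEquiv m), Nat.card_coe_set_eq]
  · intro E F h
    simpa using h
  · rintro ⟨s, E⟩ ⟨t, F⟩ h
    simpa using h
  · rw [Set.disjoint_left]
    rintro _ ⟨⟨s, E⟩, ⟨h1, -⟩, rfl⟩ ⟨F, -, h⟩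
    simp only [Prod.mk.injEq] at h h1
    omega

theorem statement8 (k n : ℕ) (hk : 2 ≤ k) (hn : k ≤ n) :
    sptd k n + sptd (k - 1) n = sptd (k - 1) (n - k + 1) + pd (n - k + 1) := by
  obtain ⟨j, rfl⟩ : ∃ j, k = j + 1 := ⟨k - 1, by omega⟩
  have hj : 1 ≤ j := by omega
  rw [Nat.add_sub_cancel, ← ncard_weakSmallestPartPairs hj,
    ← ncard_weakSmallestPartPairs_add hj]
  congr 1
  congr 1
  omega
end

section
/- For all integers k ≥ 1 and t ≥ k, B_0(k, 2t) + B_1(k+1, 2t+1) = B_0(k, 2t−2k) + p_{de}(2t−k) + p_{do}(2t−2k), where B_0 and B_1 are taken to vanish when their second argument is less than their first. -/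
/-- Pairs `(s, D)` encoding the partitions of `n` with smallest part `s` occurring `k` times and
set `D` of larger parts, distinct and incongruent to `s` modulo 2, whose number satisfies `P`. -/
def sptPairs (P : ℕ → Prop) (k n : ℕ) : Set (ℕ × Finset ℕ) :=
  {p | 0 < p.1 ∧ (∀ x ∈ p.2, p.1 < x ∧ ¬ x % 2 = p.1 % 2) ∧ P p.2.card ∧
    k * p.1 + p.2.sum id = n}

/-- Pairs `(s, D)` as in `sptPairs Even`, except that `s - 1` is allowed in `D`. -/
def weakPairs (k n : ℕ) : Set (ℕ × Finset ℕ) :=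
  {p | 0 < p.1 ∧ (∀ x ∈ p.2, p.1 ≤ x + 1 ∧ ¬ x % 2 = p.1 % 2) ∧ Even p.2.card ∧
    k * p.1 + p.2.sum id = n}

/-- Sets of positive integers satisfying `Q` with sum `n`. -/
def distinctParts (Q : ℕ → Prop) (n : ℕ) : Set (Finset ℕ) :=
  {D | (∀ x ∈ D, 0 < x ∧ Q x) ∧ D.sum id = n}

lemma card_nodup_partition (Q : ℕ → Prop) (n : ℕ) :
    Nat.card {π : n.Partition // π.parts.Nodup ∧ ∀ x ∈ π.parts, Q x} =
      (distinctParts Q n).ncard := by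
  rw [← Nat.card_coe_set_eq]
  symm
  refine Nat.card_eq_of_bijective
    (fun D : distinctParts Q n => ⟨⟨D.1.val, fun {i} hi => (D.2.1 i hi).1, by
      rw [Finset.sum_val, D.2.2]⟩, D.1.nodup, fun x hx => (D.2.1 x hx).2⟩) ⟨?_, ?_⟩
  · intro D D' h
    simp only [Subtype.mk.injEq, Nat.Partition.mk.injEq] at h
    exact Subtype.ext (Finset.val_injective h)
  · rintro ⟨π, hnd, hQ⟩
    refine ⟨⟨⟨π.parts, hnd⟩, fun x hx => ⟨π.parts_pos hx, hQ x hx⟩, ?_⟩, rfl⟩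
    rw [← Finset.sum_val, π.parts_sum]

lemma filter_lt_replicate_add {s k : ℕ} {D : Finset ℕ} (hD : ∀ x ∈ D, s < x) :
    (Multiset.replicate k s + D.val).filter (fun x => s < x) = D.val := by
  rw [Multiset.filter_add, Multiset.filter_eq_nil.2, zero_add, Multiset.filter_eq_self.2]
  · exact hD
  · intro x hx
    simp [Multiset.eq_of_mem_replicate hx]

lemma card_sptdo_partition (P : ℕ → Prop) {k : ℕ} (hk : 1 ≤ k) (n : ℕ) :
    Nat.card {π : n.Partition // ∃ s ∈ π.parts, (∀ x ∈ π.parts, s ≤ x) ∧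
      Multiset.count s π.parts = k ∧
      (∀ x ∈ π.parts, x ≠ s → Multiset.count x π.parts = 1 ∧ ¬ x % 2 = s % 2) ∧
      P (Multiset.card (π.parts.filter fun x => s < x))} = (sptPairs P k n).ncard := by
  rw [← Nat.card_coe_set_eq]
  symm
  refine Nat.card_eq_of_bijective
    (fun p : sptPairs P k n => ⟨⟨Multiset.replicate k p.1.1 + p.1.2.val, ?_, ?_⟩, ?_⟩) ⟨?_, ?_⟩
  · intro i hi
    obtain ⟨hs, hD, -⟩ := p.2
    rcases Multiset.mem_add.1 hi with h | h
    · rwa [Multiset.eq_of_mem_replicate h]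
    · exact hs.trans (hD i h).1
  · rw [Multiset.sum_add, Multiset.sum_replicate, smul_eq_mul, Finset.sum_val]
    exact p.2.2.2.2
  · obtain ⟨⟨s, D⟩, hs, hD, hP, -⟩ := p
    have hsD : s ∉ D := fun h => (hD s h).1.false
    refine ⟨s, ?_, ?_, ?_, ?_, ?_⟩
    · exact Multiset.mem_add.2 (.inl (Multiset.mem_replicate.2 ⟨by omega, rfl⟩))
    · intro x hx
      rcases Multiset.mem_add.1 hx with h | h
      · exact (Multiset.eq_of_mem_replicate h).ge
      · exact (hD x h).1.le
    · simpa [Multiset.count_eq_zero] using hsD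
    · intro x hx hxs
      have hxD : x ∈ D := by
        rcases Multiset.mem_add.1 hx with h | h
        · exact absurd (Multiset.eq_of_mem_replicate h) hxs
        · exact h
      refine ⟨?_, (hD x hxD).2⟩
      rw [Multiset.count_add, Multiset.count_eq_one_of_mem D.nodup hxD,
        Multiset.count_replicate, if_neg hxs.symm]
    · rw [filter_lt_replicate_add fun x hx => (hD x hx).1]
      exact hP
  · rintro ⟨⟨s, D⟩, hs, hD, hP⟩ ⟨⟨s', D'⟩, hs', hD', hP'⟩ h
    simp only [Subtype.mk.injEq, Nat.Partition.mk.injEq] at h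
    have key : ∀ {s s' : ℕ} {D D' : Finset ℕ}, (∀ x ∈ D', s' < x ∧ ¬ x % 2 = s' % 2) →
        Multiset.replicate k s + D.val = Multiset.replicate k s' + D'.val → s' ≤ s := by
      intro s s' D D' hD' h
      have : s ∈ Multiset.replicate k s' + D'.val := by
        rw [← h]
        exact Multiset.mem_add.2 (.inl (Multiset.mem_replicate.2 ⟨by omega, rfl⟩))
      rcases Multiset.mem_add.1 this with h | h
      · exact (Multiset.eq_of_mem_replicate h).ge
      · exact (hD' s h).1.le
    obtain rfl : s = s' := le_antisymm (key hD h.symm) (key hD' h)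
    exact Subtype.ext (Prod.ext rfl (Finset.val_injective (add_left_cancel h)))
  · rintro ⟨π, s, hs, hmin, hcount, hrest, hP⟩
    have hnd : (π.parts.filter fun x => s < x).Nodup := by
      rw [Multiset.nodup_iff_count_le_one]
      intro x
      rw [Multiset.count_filter]
      split_ifs with hx
      · by_cases hm : x ∈ π.parts
        · exact (hrest x hm hx.ne').1.le
        · simp [Multiset.count_eq_zero.2 hm]
      · exact zero_le_one
    have hparts : Multiset.replicate k s + π.parts.filter (fun x => s < x) = π.parts := by
      ext x
      rw [Multiset.count_add, Multiset.count_replicate, Multiset.count_filter]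
      rcases lt_trichotomy s x with h | rfl | h
      · simp [h, h.ne]
      · simp [hcount]
      · have : x ∉ π.parts := fun hx => (hmin x hx).not_gt h
        simp [h.ne', Multiset.count_eq_zero.2 this]
    refine ⟨⟨⟨s, ⟨_, hnd⟩⟩, π.parts_pos hs, ?_, hP, ?_⟩, ?_⟩
    · intro x hx
      obtain ⟨hx, hlt⟩ := Multiset.mem_filter.1 hx
      exact ⟨hlt, (hrest x hx hlt.ne').2⟩
    · have := congrArg Multiset.sum hparts
      rw [π.parts_sum] at this
      rw [Multiset.sum_add, Multiset.sum_replicate, smul_eq_mul] at this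
      rwa [← Finset.sum_val]
    · exact Subtype.ext (Nat.Partition.ext hparts)

lemma finite_weakPairs {k : ℕ} (hk : 1 ≤ k) (n : ℕ) : (weakPairs k n).Finite := by
  refine ((Set.finite_Iic n).prod (Finset.finite_toSet (Finset.range (n + 1)).powerset)).subset ?_
  rintro ⟨s, D⟩ ⟨-, -, -, hsum⟩
  simp only at hsum
  refine ⟨?_, ?_⟩
  · simp only [Set.mem_Iic]
    exact (Nat.le_mul_of_pos_left s hk).trans (hsum ▸ Nat.le_add_right _ _)
  · simp only [Finset.coe_powerset, Set.mem_preimage, Set.mem_powerset_iff, Finset.coe_subset]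
    intro x hx
    have := Finset.single_le_sum (f := id) (fun _ _ => Nat.zero_le _) hx
    simp only [id] at this hsum
    rw [Finset.mem_range]
    omega

/-- Splitting `weakPairs` according to whether `s - 1` is in the set. -/
lemma ncard_weakPairs_eq_sptPairs {k : ℕ} (hk : 1 ≤ k) (n : ℕ) :
    (weakPairs k n).ncard =
      (sptPairs Even k n).ncard + (sptPairs Odd (k + 1) (n + 1)).ncard := by
  rw [← Set.ncard_inter_add_ncard_sdiff_eq_ncard (weakPairs k n) {p | p.1 - 1 ∈ p.2}
    (finite_weakPairs hk n), add_comm]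
  congr 1
  · congr 1
    ext ⟨s, D⟩
    constructor
    · rintro ⟨⟨hs, hD, hcard, hsum⟩, hmem⟩
      refine ⟨hs, fun x hx => ⟨?_, (hD x hx).2⟩, hcard, hsum⟩
      have := hD x hx
      have : x ≠ s - 1 := by
        rintro rfl
        exact hmem hx
      simp only at *
      omega
    · rintro ⟨hs, hD, hcard, hsum⟩
      refine ⟨⟨hs, fun x hx => ⟨?_, (hD x hx).2⟩, hcard, hsum⟩, fun h => ?_⟩
      · have := hD x hx
        omega
      · have := hD _ h
        simp only at *
        omega
  · refine Set.ncard_congr (fun p _ => (p.1, p.2.erase (p.1 - 1))) ?_ ?_ ?_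
    · rintro ⟨s, D⟩ ⟨⟨hs, hD, hcard, hsum⟩, hmem⟩
      simp only [Set.mem_ofPred_eq] at hs hD hcard hsum hmem
      refine ⟨hs, fun x hx => ?_, ?_, ?_⟩
      · obtain ⟨hne, hx⟩ := Finset.mem_erase.1 hx
        have := hD x hx
        simp only at *
        omega
      · have := Finset.card_erase_add_one hmem
        simp only at *
        rw [← this] at hcard
        exact Nat.not_even_iff_odd.1 (Nat.even_add_one.1 hcard)
      · have := Finset.add_sum_erase D id hmem
        simp only [id] at *
        rw [add_mul]
        omega
    · rintro ⟨s, D⟩ ⟨s', D'⟩ ⟨-, hmem⟩ ⟨-, hmem'⟩ h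
      simp only [Prod.mk.injEq, Set.mem_ofPred_eq] at h hmem hmem'
      obtain ⟨rfl, h⟩ := h
      rw [← Finset.insert_erase hmem, h, Finset.insert_erase hmem']
    · rintro ⟨s, D⟩ ⟨hs, hD, hcard, hsum⟩
      simp only at hs hD hcard hsum
      have hmem : s - 1 ∉ D := fun h => by
        have := hD _ h
        omega
      refine ⟨(s, insert (s - 1) D), ⟨⟨hs, fun x hx => ?_, ?_, ?_⟩, ?_⟩, ?_⟩
      · rcases Finset.mem_insert.1 hx with rfl | hx
        · simp only
          omega
        · have := hD x hx
          simp only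
          omega
      · simp only [Finset.card_insert_of_notMem hmem]
        exact hcard.add_one
      · simp only [Finset.sum_insert hmem]
        rw [add_mul] at hsum
        simp only [id] at *
        omega
      · simp
      · simp [Finset.erase_insert hmem]

lemma ncard_weakPairs_one {k n : ℕ} (hn : k ≤ n) :
    (weakPairs k n ∩ {p | p.1 = 1}).ncard = (distinctParts Even (n - k)).ncard := by
  refine Set.ncard_congr (fun p _ => p.2.erase 0) ?_ ?_ ?_
  · rintro ⟨s, D⟩ ⟨⟨hs, hD, hcard, hsum⟩, rfl : s = 1⟩
    refine ⟨fun x hx => ?_, ?_⟩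
    · obtain ⟨hne, hx⟩ := Finset.mem_erase.1 hx
      have := hD x hx
      rw [Nat.even_iff]
      simp only at *
      omega
    · rw [Finset.sum_erase D (f := id) (a := 0) rfl]
      rw [mul_one] at hsum
      exact Nat.eq_sub_of_add_eq' hsum
  · rintro ⟨s, D⟩ ⟨s', D'⟩ ⟨⟨-, -, hcard, -⟩, rfl : s = 1⟩ ⟨⟨-, -, hcard', -⟩, rfl : s' = 1⟩ h
    simp only at h hcard hcard'
    have hc := congrArg Finset.card h
    rw [Finset.card_erase_eq_ite, Finset.card_erase_eq_ite] at hc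
    have h0 : 0 ∈ D ↔ 0 ∈ D' := by
      rw [Nat.even_iff] at hcard hcard'
      have hpos := fun h : 0 ∈ D => Finset.card_pos.2 ⟨0, h⟩
      have hpos' := fun h : 0 ∈ D' => Finset.card_pos.2 ⟨0, h⟩
      split_ifs at hc with h1 h2 h2 <;> simp only [h1, h2, iff_true, iff_false] <;> grind
    refine Prod.ext rfl (Finset.ext fun x => ?_)
    by_cases hx : x = 0
    · rw [hx]
      exact h0
    · simpa [hx] using Finset.ext_iff.1 h x
  · rintro D ⟨hD, hsum⟩
    have h0 : 0 ∉ D := fun h => (hD 0 h).1.false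
    by_cases hcard : Even D.card
    · refine ⟨(1, D), ⟨⟨one_pos, fun x hx => ?_, hcard, ?_⟩, rfl⟩, Finset.erase_eq_of_notMem h0⟩
      · have := hD x hx
        rw [Nat.even_iff] at this
        simp only
        omega
      · simp only
        omega
    · refine ⟨(1, insert 0 D), ⟨⟨one_pos, fun x hx => ?_, ?_, ?_⟩, rfl⟩, Finset.erase_insert h0⟩
      · rcases Finset.mem_insert.1 hx with rfl | hx
        · simp
        · have := hD x hx
          rw [Nat.even_iff] at this
          simp only
          omega
      · simpa [Finset.card_insert_of_notMem h0, Nat.even_add_one] using hcard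
      · simp only [Finset.sum_insert h0, id] at *
        omega

lemma even_sum_iff_even_card {D : Finset ℕ} (hD : ∀ x ∈ D, Odd x) :
    Even (D.sum id) ↔ Even D.card := by
  rw [Finset.even_sum_iff_even_card_odd, Finset.filter_true_of_mem (p := fun x => Odd (id x)) hD]

lemma ncard_weakPairs_two {k n : ℕ} (hn : 2 * k ≤ n) (heven : Even n) :
    (weakPairs k n ∩ {p | p.1 = 2}).ncard = (distinctParts Odd (n - 2 * k)).ncard := by
  refine Set.ncard_congr (fun p _ => p.2) ?_ ?_ ?_
  · rintro ⟨s, D⟩ ⟨⟨-, hD, hcard, hsum⟩, rfl : s = 2⟩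
    refine ⟨fun x hx => ?_, ?_⟩
    · have := hD x hx
      rw [Nat.odd_iff]
      simp only at *
      omega
    · simp only at *
      omega
  · rintro ⟨s, D⟩ ⟨s', D'⟩ ⟨-, rfl : s = 2⟩ ⟨-, rfl : s' = 2⟩ h
    exact Prod.ext rfl h
  · rintro D ⟨hD, hsum⟩
    refine ⟨(2, D), ⟨⟨two_pos, fun x hx => ?_, ?_, ?_⟩, rfl⟩, rfl⟩
    · have := hD x hx
      rw [Nat.odd_iff] at this
      simp only
      omega
    · rw [← even_sum_iff_even_card fun x hx => (hD x hx).2, hsum]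
      exact heven.tsub (even_two_mul k)
    · simp only
      omega

lemma ncard_weakPairs_three_le {k n : ℕ} (hn : 2 * k ≤ n) :
    (weakPairs k n ∩ {p | 3 ≤ p.1}).ncard = (sptPairs Even k (n - 2 * k)).ncard := by
  refine Set.ncard_congr (fun p _ => (p.1 - 2, p.2)) ?_ ?_ ?_
  · rintro ⟨s, D⟩ ⟨⟨-, hD, hcard, hsum⟩, hs : 3 ≤ s⟩
    obtain ⟨r, rfl⟩ := Nat.exists_eq_add_of_le' (show 2 ≤ s by omega)
    simp only at hD hsum
    refine ⟨by simp only; omega, fun x hx => ?_, hcard, ?_⟩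
    · have := hD x hx
      simp only
      omega
    · rw [mul_add] at hsum
      simp only [Nat.add_sub_cancel]
      omega
  · rintro ⟨s, D⟩ ⟨s', D'⟩ ⟨-, hs : 3 ≤ s⟩ ⟨-, hs' : 3 ≤ s'⟩ h
    simp only [Prod.mk.injEq] at h ⊢
    exact ⟨by omega, h.2⟩
  · rintro ⟨s, D⟩ ⟨hs, hD, hcard, hsum⟩
    simp only at hs hD hsum
    refine ⟨(s + 2, D), ⟨⟨Nat.succ_pos _, fun x hx => ?_, hcard, ?_⟩, ?_⟩, rfl⟩
    · have := hD x hx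
      simp only
      omega
    · simp only [mul_add]
      omega
    · simp only [Set.mem_ofPred_eq]
      omega

/-- Splitting `weakPairs` according to whether `s` is `1`, `2` or at least `3`. -/
lemma ncard_weakPairs_eq_distinctParts {k n : ℕ} (hk : 1 ≤ k) (hn : 2 * k ≤ n) (heven : Even n) :
    (weakPairs k n).ncard = (sptPairs Even k (n - 2 * k)).ncard +
      (distinctParts Even (n - k)).ncard + (distinctParts Odd (n - 2 * k)).ncard := by
  have hfin := finite_weakPairs hk n
  rw [← ncard_weakPairs_three_le hn, ← ncard_weakPairs_one (by omega : k ≤ n),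
    ← ncard_weakPairs_two hn heven, ← Set.ncard_union_eq _ (hfin.inter_of_left _)
      (hfin.inter_of_left _), ← Set.ncard_union_eq _ ((hfin.inter_of_left _).union
      (hfin.inter_of_left _)) (hfin.inter_of_left _), ← Set.inter_union_distrib_left,
    ← Set.inter_union_distrib_left]
  · congr 1
    refine (Set.inter_eq_left.2 fun p hp => ?_).symm
    have := hp.1
    simp only [Set.mem_union, Set.mem_ofPred_eq]
    omega
  · rw [← Set.inter_union_distrib_left, Set.disjoint_left]
    rintro p ⟨-, h⟩ ⟨-, h'⟩
    simp only [Set.mem_union, Set.mem_ofPred_eq] at h h'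
    omega
  · rw [Set.disjoint_left]
    rintro p ⟨-, h⟩ ⟨-, h'⟩
    simp only [Set.mem_ofPred_eq] at h h'
    omega

theorem statement13 (k t : ℕ) (hk : 1 ≤ k) (ht : k ≤ t) :
    B0 k (2 * t) + B1 (k + 1) (2 * t + 1) =
      B0 k (2 * t - 2 * k) + pde (2 * t - k) + pdo (2 * t - 2 * k) := by
  rw [show B0 k (2 * t) = _ from card_sptdo_partition Even hk _,
    show B0 k (2 * t - 2 * k) = _ from card_sptdo_partition Even hk _,
    show B1 (k + 1) (2 * t + 1) = _ from card_sptdo_partition Odd (Nat.le_add_left 1 k) _,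
    show pde (2 * t - k) = _ from card_nodup_partition Even _,
    show pdo (2 * t - 2 * k) = _ from card_nodup_partition Odd _,
    ← ncard_weakPairs_eq_sptPairs hk,
    ncard_weakPairs_eq_distinctParts hk (Nat.mul_le_mul_left 2 ht) (even_two_mul t)]
end
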